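/- Integrating factors versus contact dynamics: Let l : (ℝⁿ)^{k+1} → ℝ be smooth and γ ∈ ℝ. On smooth functions g of (t, q₀,…,q_r) (with r varying), define the time-dependent total derivative d_T g = ∂g/∂t + Σ_{β=0}^{r} q_{β+1}·(∂g/∂q_β), and on smooth functions f of (q₀,…,q_r) define the operator D f = Σ_{β=0}^{r} q_{β+1}·(∂f/∂q_β) − γ f. Then for every α ∈ ℕ, d_T^α(e^{−γt} f) = e^{−γt} D^α f, and consequently the Euler–Lagrange expressions satisfy Σ_{α=0}^{k} (−1)^α d_T^α( ∂(e^{−γt} l)/∂q_α^i ) = e^{−γt} Σ_{α=0}^{k} (−1)^α D^α( ∂l/∂q_α^i ) for all i = 1,…,n. -/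

import Mathlib

open scoped BigOperators

noncomputable section

namespace IntFactor

/-- Infinite-jet coordinates `(q_β)_{β ∈ ℕ}` with each `q_β ∈ ℝⁿ`. -/
abbrev Jet (n : ℕ) := ℕ → Fin n → ℝ

/-- Partial derivative of a time-independent jet function w.r.t. `q_β^i`. -/
def pqJ {n : ℕ} (f : Jet n → ℝ) (β : ℕ) (i : Fin n) (q : Jet n) : ℝ :=
  deriv (fun s => f (Function.update q β (Function.update (q β) i s))) (q β i)

/-- Partial derivative of a time-dependent jet function w.r.t. `q_β^i`. -/
def pqT {n : ℕ} (g : ℝ → Jet n → ℝ) (β : ℕ) (i : Fin n) (t : ℝ) (q : Jet n) : ℝ :=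
  deriv (fun s => g t (Function.update q β (Function.update (q β) i s))) (q β i)

/-- The time-dependent total derivative
`d_T g = ∂g/∂t + ∑_{β=0}^{r} q_{β+1}·∂g/∂q_β` on functions of order `r`. -/
def dT {n : ℕ} (r : ℕ) (g : ℝ → Jet n → ℝ) : ℝ → Jet n → ℝ :=
  fun t q => deriv (fun s => g s q) t
    + ∑ β ∈ Finset.range (r+1), ∑ i : Fin n, q (β+1) i * pqT g β i t q

/-- Iterated total derivative `d_T^α`, applied to a function of order `r`. -/
def dTpow {n : ℕ} (r : ℕ) : ℕ → (ℝ → Jet n → ℝ) → (ℝ → Jet n → ℝ)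
  | 0, g => g
  | (α+1), g => dT (r+α) (dTpow r α g)

/-- The dissipative operator `D f = ∑_{β=0}^{r} q_{β+1}·∂f/∂q_β − γ f`. -/
def Dop {n : ℕ} (γ : ℝ) (r : ℕ) (f : Jet n → ℝ) : Jet n → ℝ :=
  fun q => (∑ β ∈ Finset.range (r+1), ∑ i : Fin n, q (β+1) i * pqJ f β i q) - γ * f q

/-- Iterated dissipative operator `D^α`, applied to a function of order `r`. -/
def Dpow {n : ℕ} (γ : ℝ) (r : ℕ) : ℕ → (Jet n → ℝ) → (Jet n → ℝ)
  | 0, f => f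
  | (α+1), f => Dop γ (r+α) (Dpow γ r α f)

/-- Extension of a function of `(q₀,…,q_m)` to the jet space. -/
def extl {n m : ℕ} (f : (Fin (m+1) → Fin n → ℝ) → ℝ) : Jet n → ℝ :=
  fun q => f (fun β => q β.val)

theorem pqT_exp_mul {n : ℕ} (γ : ℝ) (f : Jet n → ℝ) (β : ℕ) (i : Fin n) :
    pqT (fun s p => Real.exp (-(γ * s)) * f p) β i
      = fun s p => Real.exp (-(γ * s)) * pqJ f β i p := by
  funext t q
  simp only [pqT, pqJ, deriv_const_mul_field]

theorem hasDerivAt_exp_neg_mul (γ t : ℝ) :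
    HasDerivAt (fun s => Real.exp (-(γ * s))) (-(γ * Real.exp (-(γ * t)))) t := by
  have h : HasDerivAt (fun s => -(γ * s)) (-γ) t := by
    simpa using (hasDerivAt_id t).const_mul γ |>.fun_neg
  convert h.exp using 1
  ring

/-- The total derivative conjugated by the integrating factor is the dissipative operator. -/
theorem dT_exp_mul {n : ℕ} (γ : ℝ) (r : ℕ) (f : Jet n → ℝ) :
    dT r (fun s p => Real.exp (-(γ * s)) * f p)
      = fun s p => Real.exp (-(γ * s)) * Dop γ r f p := by
  funext t q
  simp only [dT, Dop, pqT_exp_mul, deriv_mul_const_field, (hasDerivAt_exp_neg_mul γ t).deriv,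
    mul_left_comm _ (Real.exp (-(γ * t))), ← Finset.mul_sum]
  ring

theorem dTpow_exp_mul {n : ℕ} (γ : ℝ) (r α : ℕ) (f : Jet n → ℝ) :
    dTpow r α (fun s p => Real.exp (-(γ * s)) * f p)
      = fun s p => Real.exp (-(γ * s)) * Dpow γ r α f p := by
  induction α with
  | zero => rfl
  | succ α ih => rw [dTpow, ih, dT_exp_mul, Dpow]

/-- Integrating factors versus contact dynamics:
`d_T^α (e^{-γt} f) = e^{-γt} D^α f`, and consequently the Euler–Lagrange
expression of `e^{-γt} l` is `e^{-γt}` times the contact one of `l`. -/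
theorem integrating_factors_vs_contact
    {n k : ℕ} (l : (Fin (k+1) → Fin n → ℝ) → ℝ)
    (hl : ContDiff ℝ (⊤ : ℕ∞) l) (γ : ℝ) :
    (∀ (r α : ℕ) (f : (Fin (r+1) → Fin n → ℝ) → ℝ), ContDiff ℝ (⊤ : ℕ∞) f →
      ∀ (t : ℝ) (q : Jet n),
        dTpow r α (fun s p => Real.exp (-(γ * s)) * extl f p) t q
          = Real.exp (-(γ * t)) * Dpow γ r α (extl f) q) ∧
    (∀ (i : Fin n) (t : ℝ) (q : Jet n),
      ∑ α ∈ Finset.range (k+1), (-1:ℝ)^α *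
          dTpow k α (pqT (fun s p => Real.exp (-(γ * s)) * extl l p) α i) t q
        = Real.exp (-(γ * t)) *
            ∑ α ∈ Finset.range (k+1), (-1:ℝ)^α * Dpow γ k α (pqJ (extl l) α i) q) := by
  refine ⟨fun r α f _ t q => by rw [dTpow_exp_mul], fun i t q => ?_⟩
  rw [Finset.mul_sum]
  refine Finset.sum_congr rfl fun α _ => ?_
  rw [pqT_exp_mul, dTpow_exp_mul, mul_left_comm]

end IntFactor
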